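/- Let M be an invertible symmetric positive definite matrix and x, x_j ∈ ℝ^d. Then xᵀ(M + x_j x_jᵀ)⁻¹x ≥ xᵀM⁻¹x − (xᵀM⁻¹x)(x_jᵀM⁻¹x_j)/(1 + x_jᵀM⁻¹x_j). -/

import Mathlib

open Matrix

/-- The **Sherman–Morrison formula** for the inverse of a rank-one update. -/
theorem Matrix.inv_add_vecMulVec {n K : Type*} [Fintype n] [DecidableEq n] [Field K]
    {M : Matrix n n K} (hM : IsUnit M.det) (u v : n → K) (h : 1 + v ⬝ᵥ M⁻¹ *ᵥ u ≠ 0) :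
    (M + vecMulVec u v)⁻¹ =
      M⁻¹ - (1 + v ⬝ᵥ M⁻¹ *ᵥ u)⁻¹ • vecMulVec (M⁻¹ *ᵥ u) (v ᵥ* M⁻¹) := by
  apply inv_eq_right_inv
  set c := v ⬝ᵥ M⁻¹ *ᵥ u
  have h₁ : M * vecMulVec (M⁻¹ *ᵥ u) (v ᵥ* M⁻¹) = vecMulVec u (v ᵥ* M⁻¹) := by
    rw [mul_vecMulVec, mulVec_mulVec, mul_nonsing_inv _ hM, one_mulVec]
  have h₂ : vecMulVec u v * vecMulVec (M⁻¹ *ᵥ u) (v ᵥ* M⁻¹) = c • vecMulVec u (v ᵥ* M⁻¹) := by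
    rw [vecMulVec_mul_vecMulVec, vecMulVec_smul]
  have h₃ : (1 + c)⁻¹ + (1 + c)⁻¹ * c = 1 := by field_simp
  rw [add_mul, mul_sub, mul_sub, Matrix.mul_smul, Matrix.mul_smul, h₁, h₂, mul_nonsing_inv _ hM,
    vecMulVec_mul, smul_smul, sub_add_sub_comm, ← add_smul, h₃, one_smul, add_sub_cancel_right]

/-- The **Cauchy–Schwarz inequality** for a real positive semidefinite matrix. -/
theorem Matrix.PosSemidef.sq_dotProduct_mulVec_le {n : Type*} [Fintype n] {A : Matrix n n ℝ}
    (hA : A.PosSemidef) (x y : n → ℝ) :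
    (x ⬝ᵥ A *ᵥ y) ^ 2 ≤ (x ⬝ᵥ A *ᵥ x) * (y ⬝ᵥ A *ᵥ y) := by
  have hsymm : y ⬝ᵥ A *ᵥ x = x ⬝ᵥ A *ᵥ y := by
    have hT : Aᵀ = A := by simpa using hA.isHermitian.eq
    rw [dotProduct_mulVec, ← mulVec_transpose, hT, dotProduct_comm]
  have hquad (t : ℝ) :
      0 ≤ (y ⬝ᵥ A *ᵥ y) * (t * t) + 2 * (x ⬝ᵥ A *ᵥ y) * t + x ⬝ᵥ A *ᵥ x := by
    have h := hA.dotProduct_mulVec_nonneg (x + t • y)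
    simp only [star_trivial, mulVec_add, mulVec_smul, add_dotProduct, dotProduct_add,
      smul_dotProduct, dotProduct_smul, smul_eq_mul, hsymm] at h
    linarith
  have hdiscrim := discrim_le_zero hquad
  rw [discrim] at hdiscrim
  linarith

/-- Sherman–Morrison plus Cauchy–Schwarz:
`xᵀ (M + x_j x_jᵀ)⁻¹ x ≥ xᵀ M⁻¹ x − (xᵀ M⁻¹ x)(x_jᵀ M⁻¹ x_j)/(1 + x_jᵀ M⁻¹ x_j)`
for positive definite `M`. -/
theorem sherman_morrison_quadform_lower_bound
    {d : ℕ} (M : Matrix (Fin d) (Fin d) ℝ) (hM : M.PosDef) (x xj : Fin d → ℝ) :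
    x ⬝ᵥ M⁻¹.mulVec x -
        (x ⬝ᵥ M⁻¹.mulVec x) * (xj ⬝ᵥ M⁻¹.mulVec xj) / (1 + xj ⬝ᵥ M⁻¹.mulVec xj)
      ≤ x ⬝ᵥ (M + Matrix.vecMulVec xj xj)⁻¹.mulVec x := by
  have hc : 0 ≤ xj ⬝ᵥ M⁻¹ *ᵥ xj := by
    simpa using hM.inv.posSemidef.dotProduct_mulVec_nonneg xj
  have hT : M⁻¹ᵀ = M⁻¹ := by simpa using hM.inv.isHermitian.eq
  have hsymm : xj ᵥ* M⁻¹ = M⁻¹ *ᵥ xj := by rw [← mulVec_transpose, hT]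
  have hform : x ⬝ᵥ (M + vecMulVec xj xj)⁻¹ *ᵥ x =
      x ⬝ᵥ M⁻¹ *ᵥ x - (x ⬝ᵥ M⁻¹ *ᵥ xj) ^ 2 / (1 + xj ⬝ᵥ M⁻¹ *ᵥ xj) := by
    rw [inv_add_vecMulVec hM.det_pos.ne'.isUnit xj xj (by positivity), hsymm, sub_mulVec,
      smul_mulVec, vecMulVec_mulVec, dotProduct_sub, dotProduct_smul, dotProduct_comm _ x]
    simp only [op_smul_eq_smul, dotProduct_smul, smul_eq_mul]
    ring
  rw [hform]
  gcongr
  exact hM.inv.posSemidef.sq_dotProduct_mulVec_le x xj
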